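/- arXiv:2508.12859 — 4 statements merged into one kernel-verified Lean document; each statement's English description precedes it below -/
import Mathlib

section
/- Let p be a prime and k ≥ 2 an integer, and set q = p^k. For every x ∈ Z_q, the homogeneous weight wt(x) satisfies wt(x) = λ·(1 − (1/φ(q))·Σ_{a ∈ (Z_q)^×} ζ_q^{a·x}), where λ = (p−1)p^{k−2}, (Z_q)^× is the group of units of Z_q, φ is Euler's totient function, and ζ_q = exp(2πi/q). -/
open Classical

/-- `ζ_q^x = exp(2πi·x/q)` for `x ∈ ℤ/q`. -/
noncomputable def zetaPow (q : ℕ) (x : ZMod q) : ℂ :=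
  Complex.exp (2 * Real.pi * Complex.I * x.val / q)

/-- The homogeneous weight on `ℤ/p^k` (`p` prime, `k ≥ 2`): `wt(0) = 0`,
`wt(x) = p^{k-1}` for nonzero `x ∈ p^{k-1}·ℤ/p^k`, and `wt(x) = (p-1)p^{k-2}` otherwise. -/
noncomputable def homWeight (p k : ℕ) (x : ZMod (p ^ k)) : ℝ :=
  if x = 0 then 0
  else if x ∈ Set.range (fun y : ZMod (p ^ k) => (p : ZMod (p ^ k)) ^ (k - 1) * y)
  then (p : ℝ) ^ (k - 1)
  else ((p : ℝ) - 1) * (p : ℝ) ^ (k - 2)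

theorem zetaPow_eq_stdAddChar (q : ℕ) [NeZero q] (x : ZMod q) :
    zetaPow q x = ZMod.stdAddChar x := by
  have h := ZMod.stdAddChar_coe (N := q) (x.val : ℤ)
  rw [Int.cast_natCast, ZMod.natCast_zmod_val] at h
  rw [h, zetaPow]
  simp

theorem sum_units_eq_sum_ite {R M : Type*} [Monoid R] [Fintype R] [Fintype Rˣ] [AddCommMonoid M]
    [DecidablePred (IsUnit : R → Prop)]
    (f : R → M) : ∑ a : Rˣ, f a = ∑ a : R, if IsUnit a then f a else 0 := by
  rw [← Finset.sum_filter]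
  refine Finset.sum_nbij (fun a => (a : R)) ?_ ?_ ?_ ?_
  · intro a _
    simp
  · intro a _ b _ h
    exact Units.ext h
  · intro a ha
    obtain ⟨u, rfl⟩ : IsUnit a := by simpa using ha
    exact ⟨u, by simp⟩
  · intro a _
    rfl

theorem dvd_of_not_isUnit_zmod_prime_pow {p k : ℕ} (hp : p.Prime) [NeZero (p ^ k)]
    {a : ZMod (p ^ k)} (ha : ¬ IsUnit a) : (p : ZMod (p ^ k)) ∣ a := by
  rw [← ZMod.natCast_zmod_val a, ZMod.isUnit_iff_coprime] at ha
  rw [← ZMod.natCast_zmod_val a]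
  refine Nat.cast_dvd_cast ?_
  by_contra h
  exact ha (((hp.coprime_iff_not_dvd.mpr h).symm).pow_right k)

theorem mem_range_prime_pow_mul_iff {p k : ℕ} (hp : p.Prime) (hk : 1 ≤ k) [NeZero (p ^ k)]
    (x : ZMod (p ^ k)) :
    x ∈ Set.range (fun y : ZMod (p ^ k) => (p : ZMod (p ^ k)) ^ (k - 1) * y) ↔
      (p : ZMod (p ^ k)) * x = 0 := by
  constructor
  · rintro ⟨y, rfl⟩
    change (p : ZMod (p ^ k)) * ((p : ZMod (p ^ k)) ^ (k - 1) * y) = 0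
    rw [← mul_assoc, ← pow_succ', Nat.sub_add_cancel hk, ← Nat.cast_pow, ZMod.natCast_self,
      zero_mul]
  · intro h
    rw [← ZMod.natCast_zmod_val x, ← Nat.cast_mul, ZMod.natCast_eq_zero_iff] at h
    have h' : p * p ^ (k - 1) ∣ p * x.val := by
      rwa [← pow_succ', Nat.sub_add_cancel hk]
    obtain ⟨c, hc⟩ := Nat.dvd_of_mul_dvd_mul_left hp.pos h'
    refine ⟨c, ?_⟩
    change (p : ZMod (p ^ k)) ^ (k - 1) * (c : ZMod (p ^ k)) = x
    rw [← ZMod.natCast_zmod_val x, hc]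
    push_cast
    rfl

/-- The sum of an additive character over the units vanishes when translation by a nilpotent
element multiplies it by a factor different from `1`. -/
theorem sum_units_addChar_eq_zero {R : Type*} [CommRing R] [Fintype R] [Fintype Rˣ]
    (ψ : AddChar R ℂ) {n x : R} (hn : IsNilpotent n) (h : ψ (n * x) ≠ 1) :
    ∑ a : Rˣ, ψ (a * x) = 0 := by
  rw [sum_units_eq_sum_ite (fun a : R => ψ (a * x))]
  set S := ∑ a : R, if IsUnit a then ψ (a * x) else 0 with hS
  have key : S = S * ψ (n * x) := by
    conv_lhs => rw [hS, ← Equiv.sum_comp (Equiv.addRight n)]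
    rw [hS, Finset.sum_mul]
    refine Finset.sum_congr rfl fun a _ => ?_
    have hu : IsUnit (a + n) ↔ IsUnit a := by
      constructor
      · intro ha
        simpa using hn.neg.isUnit_add_left_of_commute ha (Commute.all _ _)
      · intro ha
        exact hn.isUnit_add_left_of_commute ha (Commute.all _ _)
    simp only [Equiv.coe_addRight, hu, add_mul, AddChar.map_add_eq_mul, ite_mul, zero_mul]
  have h0 : S * (ψ (n * x) - 1) = 0 := by linear_combination -key
  exact (mul_eq_zero.mp h0).resolve_right (sub_ne_zero.mpr h)

theorem sum_units_stdAddChar_of_prime_mul_eq_zero {p k : ℕ} (hp : p.Prime) [NeZero (p ^ k)]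
    {x : ZMod (p ^ k)} (hx : x ≠ 0) (hpx : (p : ZMod (p ^ k)) * x = 0) :
    ∑ a : (ZMod (p ^ k))ˣ, (ZMod.stdAddChar ((a : ZMod (p ^ k)) * x) : ℂ) =
      (Nat.totient (p ^ k) : ℂ) - (p : ℂ) ^ k := by
  have hcard : ∑ _a : (ZMod (p ^ k))ˣ, (1 : ℂ) = Nat.totient (p ^ k) := by
    rw [Finset.sum_const, Finset.card_univ, ZMod.card_units_eq_totient]
    simp
  have hall : ∑ a : ZMod (p ^ k), (ZMod.stdAddChar (a * x) : ℂ) = 0 := by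
    rw [AddChar.sum_mulShift x (ZMod.isPrimitive_stdAddChar (p ^ k))]
    simp [hx]
  have hterm : ∀ a : ZMod (p ^ k),
      (if IsUnit a then (ZMod.stdAddChar (a * x) : ℂ) else 0) =
        (ZMod.stdAddChar (a * x) : ℂ) - 1 + if IsUnit a then 1 else 0 := by
    intro a
    by_cases ha : IsUnit a
    · simp [ha]
    · obtain ⟨b, rfl⟩ := dvd_of_not_isUnit_zmod_prime_pow hp ha
      have : (p : ZMod (p ^ k)) * b * x = 0 := by linear_combination b * hpx
      simp [ha, this]
  rw [sum_units_eq_sum_ite (fun a : ZMod (p ^ k) => (ZMod.stdAddChar (a * x) : ℂ)),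
    Finset.sum_congr rfl fun a _ => hterm a, Finset.sum_add_distrib, Finset.sum_sub_distrib, hall,
    ← sum_units_eq_sum_ite (fun _ : ZMod (p ^ k) => (1 : ℂ)), hcard]
  simp [ZMod.card]
  ring

/-- for `q = p^k` (`p` prime, `k ≥ 2`) and any `x ∈ ℤ/q`,
`wt(x) = λ·(1 − (1/φ(q))·∑_{a ∈ (ℤ/q)ˣ} ζ_q^{a·x})` with `λ = (p-1)p^{k-2}`. -/
theorem homWeight_eq_honold_formula (p k : ℕ) (hp : p.Prime) (hk : 2 ≤ k)
    [NeZero (p ^ k)] (x : ZMod (p ^ k)) :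
    (homWeight p k x : ℂ) =
      (((p : ℂ) - 1) * (p : ℂ) ^ (k - 2)) *
        (1 - (1 / (Nat.totient (p ^ k) : ℂ)) *
          ∑ a : (ZMod (p ^ k))ˣ, zetaPow (p ^ k) ((a : ZMod (p ^ k)) * x)) := by
  have hp0 : (p : ℂ) ≠ 0 := Nat.cast_ne_zero.mpr hp.ne_zero
  have hp1 : (p : ℂ) - 1 ≠ 0 := sub_ne_zero.mpr (by exact_mod_cast hp.one_lt.ne')
  have htot : (Nat.totient (p ^ k) : ℂ) = (p : ℂ) ^ (k - 1) * ((p : ℂ) - 1) := by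
    rw [Nat.totient_prime_pow hp (by omega), Nat.cast_mul, Nat.cast_pow, Nat.cast_pred hp.pos]
  have htot0 : (Nat.totient (p ^ k) : ℂ) ≠ 0 := by
    rw [htot]
    exact mul_ne_zero (pow_ne_zero _ hp0) hp1
  simp only [zetaPow_eq_stdAddChar]
  unfold homWeight
  rw [mem_range_prime_pow_mul_iff hp (by omega)]
  split_ifs with hx hpx
  · subst hx
    have hone : 1 / (Nat.totient (p ^ k) : ℂ) * Nat.totient (p ^ k) = 1 := one_div_mul_cancel htot0
    simp only [mul_zero, AddChar.map_zero_eq_one, Finset.sum_const, Finset.card_univ,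
      ZMod.card_units_eq_totient, nsmul_eq_mul, mul_one, hone, sub_self, Complex.ofReal_zero]
  · rw [sum_units_stdAddChar_of_prime_mul_eq_zero hp hx hpx, htot]
    obtain ⟨m, rfl⟩ := Nat.exists_eq_add_of_le' hk
    simp only [Nat.add_sub_cancel, show m + 2 - 1 = m + 1 by omega]
    push_cast
    field_simp
    ring
  · have hnil : IsNilpotent (p : ZMod (p ^ k)) :=
      ⟨k, by rw [← Nat.cast_pow, ZMod.natCast_self]⟩
    have hψ : (ZMod.stdAddChar ((p : ZMod (p ^ k)) * x) : ℂ) ≠ 1 := by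
      rw [← AddChar.map_zero_eq_one (ZMod.stdAddChar (N := p ^ k))]
      exact fun h => hpx (ZMod.injective_stdAddChar h)
    rw [sum_units_addChar_eq_zero _ hnil hψ]
    push_cast
    ring
end

section
/- Let p be a prime, k ≥ 2 an integer, let C ⊆ (Z_{p^k})^n be a finite code of strength 1, and let 𝐯 ∈ (Z_{p^k})^n. Then Σ_{𝐮 ∈ 𝐯 + C} wt(𝐮) = n·(p^{k−1} − p^{k−2})·|C|, where wt is the homogeneous weight on Z_{p^k} and the sum is over all translates 𝐯 + 𝐜 with 𝐜 ∈ C (counted with multiplicity). -/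
open Classical

/-- The multiples of `p ^ (k - 1)` in `ℤ/p^k` are exactly `p` in number. -/
theorem card_filter_mem_range_pow_mul (p k : ℕ) [NeZero (p ^ k)] (hp : p.Prime) (hk : 1 ≤ k) :
    (Finset.univ.filter (fun x : ZMod (p ^ k) =>
      x ∈ Set.range (fun y : ZMod (p ^ k) => (p : ZMod (p ^ k)) ^ (k - 1) * y))).card = p := by
  have hrange : Set.range (fun y : ZMod (p ^ k) => (p : ZMod (p ^ k)) ^ (k - 1) * y) =
      (AddSubgroup.zmultiples ((p ^ (k - 1) : ℕ) : ZMod (p ^ k)) : Set (ZMod (p ^ k))) := by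
    ext x
    simp only [Set.mem_range, SetLike.mem_coe, AddSubgroup.mem_zmultiples_iff]
    constructor
    · rintro ⟨y, rfl⟩
      obtain ⟨z, rfl⟩ := ZMod.intCast_surjective y
      exact ⟨z, by simp [mul_comm]⟩
    · rintro ⟨z, rfl⟩
      exact ⟨z, by simp [mul_comm]⟩
  have hcard := Nat.card_zmultiples ((p ^ (k - 1) : ℕ) : ZMod (p ^ k))
  rw [ZMod.addOrderOf_coe _ (NeZero.ne _),
    Nat.gcd_eq_right (pow_dvd_pow p (Nat.sub_le k 1)),
    Nat.pow_div (Nat.sub_le k 1) hp.pos, Nat.sub_sub_self hk, pow_one] at hcard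
  rw [← Fintype.card_subtype, ← Nat.card_eq_fintype_card, hrange]
  exact hcard

/-- The homogeneous weight has average `p^{k-1} - p^{k-2}` over `ℤ/p^k`. -/
theorem sum_homWeight (p k : ℕ) [NeZero (p ^ k)] (hp : p.Prime) (hk : 2 ≤ k) :
    ∑ x, homWeight p k x = (p : ℝ) ^ k * ((p : ℝ) ^ (k - 1) - (p : ℝ) ^ (k - 2)) := by
  have hcard := card_filter_mem_range_pow_mul p k hp (by omega)
  have hpow : (p : ℝ) ^ (k - 1) = p * (p : ℝ) ^ (k - 2) := by
    rw [← pow_succ']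
    congr 1
    omega
  have hweight : ∀ x : ZMod (p ^ k), homWeight p k x = ((p : ℝ) - 1) * (p : ℝ) ^ (k - 2) +
      (if x ∈ Set.range (fun y : ZMod (p ^ k) => (p : ZMod (p ^ k)) ^ (k - 1) * y)
        then (p : ℝ) ^ (k - 2) else 0) - (if x = 0 then (p : ℝ) ^ (k - 1) else 0) := by
    intro x
    unfold homWeight
    by_cases h0 : x = 0
    · have hmem : x ∈ Set.range (fun y : ZMod (p ^ k) => (p : ZMod (p ^ k)) ^ (k - 1) * y) :=
        ⟨0, by simp [h0]⟩
      rw [if_pos h0, if_pos hmem, if_pos h0, hpow]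
      ring
    · rw [if_neg h0, if_neg h0, hpow]
      split_ifs <;> ring
  rw [Finset.sum_congr rfl fun x _ => hweight x, Finset.sum_sub_distrib, Finset.sum_add_distrib,
    ← Finset.sum_filter, Finset.sum_const, Finset.sum_const, hcard, Finset.card_univ, ZMod.card,
    Finset.sum_ite_eq' Finset.univ, if_pos (Finset.mem_univ _), nsmul_eq_mul, nsmul_eq_mul, hpow]
  push_cast
  ring

/-- If `g` takes every value equally often on `C`, then summing `f (a + g c)` over `C` is
averaging `f` over the whole group. -/
theorem card_mul_sum_add_of_equidistributed {ι G : Type*} [AddCommGroup G]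
    [Fintype G] [DecidableEq G]
    (C : Finset ι) (g : ι → G) (N : ℕ)
    (hg : ∀ α, N * (C.filter (fun c => g c = α)).card = C.card) (f : G → ℝ) (a : G) :
    (N : ℝ) * ∑ c ∈ C, f (a + g c) = C.card * ∑ x, f x := by
  rw [← Finset.sum_fiberwise C g, Finset.mul_sum, ← Equiv.sum_comp (Equiv.addLeft a) f,
    Finset.mul_sum]
  refine Finset.sum_congr rfl fun α _ => ?_
  have hconst : ∀ c ∈ C.filter (fun c => g c = α), f (a + g c) = f (a + α) := by
    intro c hc
    rw [(Finset.mem_filter.mp hc).2]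
  rw [Finset.sum_congr rfl hconst, Finset.sum_const, nsmul_eq_mul, ← mul_assoc, ← hg α]
  simp

/-- if `p` is prime, `k ≥ 2`, and `C ⊆ (ℤ/p^k)^n` is a (finite) code of
strength 1 (each coordinate takes each value exactly `|C|/p^k` times), then for every
`𝐯 ∈ (ℤ/p^k)^n`, `∑_{𝐮 ∈ 𝐯 + C} wt(𝐮) = n·(p^{k-1} − p^{k-2})·|C|`. -/
theorem sum_homWeight_translate_strength_one (p k n : ℕ) (hp : p.Prime) (hk : 2 ≤ k)
    (C : Finset (Fin n → ZMod (p ^ k)))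
    (hstr : ∀ i : Fin n, ∀ α : ZMod (p ^ k),
      p ^ k * (C.filter (fun c => c i = α)).card = C.card)
    (v : Fin n → ZMod (p ^ k)) :
    ∑ c ∈ C, ∑ i, homWeight p k ((v + c) i) =
      (n : ℝ) * ((p : ℝ) ^ (k - 1) - (p : ℝ) ^ (k - 2)) * C.card := by
  have hne : p ^ k ≠ 0 := pow_ne_zero k hp.ne_zero
  have : NeZero (p ^ k) := ⟨hne⟩
  have hpk : (p : ℝ) ^ k ≠ 0 := by exact_mod_cast hne
  have hcoord : ∀ i : Fin n, ∑ c ∈ C, homWeight p k ((v + c) i) =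
      ((p : ℝ) ^ (k - 1) - (p : ℝ) ^ (k - 2)) * C.card := by
    intro i
    have h := card_mul_sum_add_of_equidistributed C (fun c => c i) (p ^ k) (hstr i)
      (homWeight p k) (v i)
    rw [sum_homWeight p k hp hk] at h
    push_cast at h
    apply mul_left_cancel₀ hpk
    simp only [Pi.add_apply]
    rw [h]
    ring
  rw [Finset.sum_comm, Finset.sum_congr rfl fun i _ => hcoord i, Finset.sum_const,
    Finset.card_univ, Fintype.card_fin, nsmul_eq_mul, mul_assoc]
end

section
/- Let p be a prime and let C ⊆ (Z_p)^n be a finite code of strength 2 with |C| = n·p, and let 𝐯 ∈ (Z_p)^n. Then Σ_{𝐮 ∈ 𝐯 + C} wt(𝐮)² = n²·(p−1)·((p−1)·|C| + p), where wt is the homogeneous weight on Z_p and the sum is over all translates 𝐯 + 𝐜 with 𝐜 ∈ C (counted with multiplicity). -/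
/-- In a code of strength 2 with `n * p` words, every coordinate takes every value
exactly `n` times. -/
theorem card_filter_coord_eq (p n : ℕ) (hp : p.Prime)
    (C : Finset (Fin n → ZMod p)) (hcard : C.card = n * p)
    (hstr : ∀ i j : Fin n, i ≠ j → ∀ s t : ZMod p,
      p ^ 2 * (C.filter (fun c => c i = s ∧ c j = t)).card = C.card)
    (i : Fin n) (s : ZMod p) : (C.filter (fun c => c i = s)).card = n := by
  have : Fact p.Prime := ⟨hp⟩
  have hp0 := hp.pos
  by_cases h : ∃ j, i ≠ j
  · obtain ⟨j, hij⟩ := h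
    have h1 : (C.filter (fun c => c i = s)).card =
        ∑ t : ZMod p, (C.filter (fun c => c i = s ∧ c j = t)).card := by
      rw [Finset.card_eq_sum_card_fiberwise (f := fun c => c j) (t := Finset.univ)
        (fun _ _ => Finset.mem_coe.2 (Finset.mem_univ _))]
      simp only [Finset.filter_filter]
    have h2 : p ^ 2 * (C.filter (fun c => c i = s)).card = p ^ 2 * n := by
      rw [h1, Finset.mul_sum, Finset.sum_congr rfl (fun t _ => hstr i j hij s t),
        Finset.sum_const, Finset.card_univ, ZMod.card, hcard, smul_eq_mul]
      ring
    exact Nat.eq_of_mul_eq_mul_left (by positivity) h2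
  · push Not at h
    have hn : n = 1 := by
      have : Fintype.card (Fin n) = 1 := Fintype.card_eq_one_iff.2 ⟨i, fun y => (h y).symm⟩
      simpa using this
    subst hn
    have hC : C = Finset.univ := by
      apply Finset.eq_univ_of_card
      simp [hcard, ZMod.card]
    rw [Finset.card_eq_one]
    refine ⟨fun _ => s, ?_⟩
    ext c
    simp only [hC, Finset.mem_filter, Finset.mem_univ, true_and, Finset.mem_singleton]
    constructor
    · intro hc
      funext k
      rw [← h k, hc]
    · rintro rfl
      rfl


open Classical

/-- The homogeneous weight on `ℤ/p` (normalization `λ = φ(p) = p−1`): `wt(0) = 0` and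
`wt(x) = p` for `x ≠ 0`. -/
noncomputable def homWtP (p : ℕ) (x : ZMod p) : ℝ :=
  if x = 0 then 0 else (p : ℝ)

/-- let `p` be prime and `C ⊆ (ℤ/p)^n` a (finite) code of strength 2
(every pair of distinct positions takes every pair of values exactly `|C|/p²` times)
with `|C| = n·p`.  Then for every `𝐯 ∈ (ℤ/p)^n`,
`∑_{𝐮 ∈ 𝐯 + C} wt(𝐮)² = n²·(p−1)·((p−1)·|C| + p)`. -/
theorem sum_sq_homWt_translate_strength_two (p n : ℕ) (hp : p.Prime)
    (C : Finset (Fin n → ZMod p)) (hcard : C.card = n * p)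
    (hstr : ∀ i j : Fin n, i ≠ j → ∀ s t : ZMod p,
      p ^ 2 * (C.filter (fun c => c i = s ∧ c j = t)).card = C.card)
    (v : Fin n → ZMod p) :
    ∑ c ∈ C, (∑ i, homWtP p ((v + c) i)) ^ 2 =
      (n : ℝ) ^ 2 * ((p : ℝ) - 1) * (((p : ℝ) - 1) * C.card + p) := by
  have hp0 : (p : ℝ) ≠ 0 := by exact_mod_cast hp.ne_zero
  have hzero : ∀ (c : Fin n → ZMod p) i, (v + c) i = 0 ↔ c i = -v i := fun c i => by
    rw [Pi.add_apply, add_comm, add_eq_zero_iff_eq_neg]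
  have hM : (C.card : ℝ) = n * p := by exact_mod_cast hcard
  set z : (Fin n → ZMod p) → Fin n → ℝ := fun c i => if c i = -v i then 1 else 0 with hz
  have hw : ∀ c, ∑ i, homWtP p ((v + c) i) = p * (n - ∑ i, z c i) := fun c => by
    have hi : ∀ i, homWtP p ((v + c) i) = p * (1 - z c i) := fun i => by
      simp only [homWtP, hzero, hz]
      split_ifs <;> ring
    simp only [hi, ← Finset.mul_sum, Finset.sum_sub_distrib]
    simp
  have h1 : ∀ i, ∑ c ∈ C, z c i = n := fun i => by
    simp only [hz, Finset.sum_boole]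
    exact_mod_cast card_filter_coord_eq p n hp C hcard hstr i (-v i)
  have h2 : ∀ i j, ∑ c ∈ C, z c i * z c j = if i = j then (n : ℝ) else n / p := fun i j => by
    split_ifs with hij
    · subst hij
      rw [← h1 i]
      refine Finset.sum_congr rfl fun c _ => ?_
      simp only [hz]
      split_ifs <;> simp
    · have h3 : ∑ c ∈ C, z c i * z c j =
          ((C.filter (fun c => c i = -v i ∧ c j = -v j)).card : ℝ) := by
        rw [← Finset.sum_boole]
        refine Finset.sum_congr rfl fun c _ => ?_
        simp only [hz]
        split_ifs <;> simp_all
      have h4 : (p : ℝ) ^ 2 * ((C.filter (fun c => c i = -v i ∧ c j = -v j)).card : ℝ) = n * p := by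
        rw [← hM]
        exact_mod_cast hstr i j hij (-v i) (-v j)
      rw [h3, eq_div_iff hp0]
      apply mul_left_cancel₀ hp0
      linear_combination h4
  have hS1 : ∑ c ∈ C, ∑ i, z c i = (n : ℝ) ^ 2 := by
    rw [Finset.sum_comm, Finset.sum_congr rfl fun i _ => h1 i]
    simp [sq]
  have hS2 : ∑ c ∈ C, (∑ i, z c i) ^ 2 = (n : ℝ) * (n + (n - 1) * (n / p)) := by
    have hrow : ∀ i : Fin n, ∑ j, (if i = j then (n : ℝ) else n / p) =
        n + (n - 1) * (n / p) := fun i => by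
      have h5 : ∀ j, (if i = j then (n : ℝ) else n / p) =
          n / p + if i = j then (n : ℝ) - n / p else 0 := fun j => by
        split_ifs <;> ring
      simp only [h5, Finset.sum_add_distrib, Finset.sum_ite_eq, Finset.mem_univ, if_true,
        Finset.sum_const, Finset.card_univ, Fintype.card_fin, nsmul_eq_mul]
      ring
    simp only [sq, Finset.sum_mul_sum]
    rw [Finset.sum_comm]
    simp only [Finset.sum_comm (s := C), h2, hrow, Finset.sum_const,
      Finset.card_univ, Fintype.card_fin, nsmul_eq_mul]
  have hexp : ∀ c, (∑ i, homWtP p ((v + c) i)) ^ 2 =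
      (p : ℝ) ^ 2 * n ^ 2 - 2 * p ^ 2 * n * ∑ i, z c i + p ^ 2 * (∑ i, z c i) ^ 2 := fun c => by
    rw [hw]
    ring
  simp only [hexp, Finset.sum_add_distrib, Finset.sum_sub_distrib, ← Finset.mul_sum, hS1, hS2,
    Finset.sum_const, nsmul_eq_mul, hM]
  field_simp
  ring
end

section
/- Let p be a prime and let C ⊆ (Z_p)^n be a nonempty self-complementary code. Then for every 𝐯 ∈ (Z_p)^n there exists a codeword 𝐜 ∈ C with homogeneous distance d(𝐯,𝐜) ≤ n·(p−1); that is, the covering radius of C for the homogeneous distance satisfies r(C) ≤ n·(p−1). -/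
open Classical

/-- The homogeneous distance between two vectors in `(ℤ/p)^n`. -/
noncomputable def homDistP (p n : ℕ) (u v : Fin n → ZMod p) : ℝ :=
  ∑ i, homWtP p (u i - v i)

/-- The covering radius of a code `C ⊆ (ℤ/p)^n` for the homogeneous distance. -/
noncomputable def covRadP (p n : ℕ) (C : Set (Fin n → ZMod p)) : ℝ :=
  ⨆ x : Fin n → ZMod p, ⨅ c : C, homDistP p n x c

theorem sum_homWtP_sub (p : ℕ) [Fact p.Prime] (a : ZMod p) :
    ∑ ω : ZMod p, homWtP p (a - ω) = (p : ℝ) * ((p : ℝ) - 1) := by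
  have hsplit (ω : ZMod p) : homWtP p (a - ω) = (p : ℝ) - if a = ω then (p : ℝ) else 0 := by
    by_cases h : a = ω <;> simp [homWtP, h, sub_eq_zero]
  simp only [hsplit, Finset.sum_sub_distrib, Finset.sum_ite_eq, Finset.mem_univ, if_true,
    Finset.sum_const, Finset.card_univ, ZMod.card, nsmul_eq_mul]
  ring

theorem sum_homDistP_add_const (p n : ℕ) [Fact p.Prime] (v c : Fin n → ZMod p) :
    ∑ ω : ZMod p, homDistP p n v (fun i => c i + ω) = (n : ℝ) * ((p : ℝ) * ((p : ℝ) - 1)) := by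
  simp only [homDistP]
  rw [Finset.sum_comm]
  simp [← sub_sub, sum_homWtP_sub]

theorem homDistP_nonneg (p n : ℕ) (u v : Fin n → ZMod p) : 0 ≤ homDistP p n u v :=
  Finset.sum_nonneg fun i _ => by
    unfold homWtP
    split_ifs <;> positivity

theorem exists_homDistP_add_const_le (p n : ℕ) [Fact p.Prime] (v c : Fin n → ZMod p) :
    ∃ ω : ZMod p, homDistP p n v (fun i => c i + ω) ≤ (n : ℝ) * ((p : ℝ) - 1) := by
  obtain ⟨ω, -, hω⟩ := Finset.exists_le_of_sum_le
    (s := (Finset.univ : Finset (ZMod p))) (f := fun ω => homDistP p n v (fun i => c i + ω))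
    (g := fun _ => (n : ℝ) * ((p : ℝ) - 1)) Finset.univ_nonempty (by
      rw [sum_homDistP_add_const, Finset.sum_const, Finset.card_univ, ZMod.card, nsmul_eq_mul]
      exact le_of_eq (by ring))
  exact ⟨ω, hω⟩

/-- if `p` is prime and `C ⊆ (ℤ/p)^n` is a nonempty self-complementary
code (closed under adding `ω·𝟏` for all `ω ∈ ℤ/p`), then every `𝐯 ∈ (ℤ/p)^n` has a
codeword within homogeneous distance `n·(p−1)`; that is, `r(C) ≤ n·(p−1)`. -/
theorem covRad_le_of_selfComplementary (p n : ℕ) (hp : p.Prime)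
    (C : Finset (Fin n → ZMod p)) (hC : C.Nonempty)
    (hsc : ∀ c ∈ C, ∀ ω : ZMod p, (fun i => c i + ω) ∈ C) :
    (∀ v : Fin n → ZMod p, ∃ c ∈ C, homDistP p n v c ≤ (n : ℝ) * ((p : ℝ) - 1)) ∧
    covRadP p n (↑C : Set (Fin n → ZMod p)) ≤ (n : ℝ) * ((p : ℝ) - 1) := by
  have : Fact p.Prime := ⟨hp⟩
  have key (v : Fin n → ZMod p) : ∃ c ∈ C, homDistP p n v c ≤ (n : ℝ) * ((p : ℝ) - 1) := by
    obtain ⟨c, hc⟩ := hC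
    obtain ⟨ω, hω⟩ := exists_homDistP_add_const_le p n v c
    exact ⟨_, hsc c hc ω, hω⟩
  refine ⟨key, ciSup_le fun v => ?_⟩
  obtain ⟨c, hc, hle⟩ := key v
  have hbdd : BddBelow (Set.range fun c : (↑C : Set (Fin n → ZMod p)) => homDistP p n v c) :=
    ⟨0, Set.forall_mem_range.2 fun c => homDistP_nonneg p n v c⟩
  exact (ciInf_le hbdd ⟨c, hc⟩).trans hle
end
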